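/- arXiv:2011.13002 — 6 statements merged into one kernel-verified Lean document; each statement's English description precedes it below -/
import Mathlib

section
/- Let p be a prime and B a type. In the multivariate polynomial ring (ZMod p)[X_{(b,k)} : b ∈ B, k ∈ ℕ], let I be the ideal generated by the set {X_{(b,k+1)} − (X_{(b,k)})^p : b ∈ B, k ∈ ℕ}. Then the (ZMod p)-algebra homomorphism (ZMod p)[X_{(b,k)} : b ∈ B, k ∈ ℕ] → (ZMod p)[X_b : b ∈ B] determined on generators by X_{(b,k)} ↦ (X_b)^{p^k} descends to an isomorphism of (ZMod p)-algebras ((ZMod p)[X_{(b,k)} : b ∈ B, k ∈ ℕ])/I ≅ (ZMod p)[X_b : b ∈ B], with inverse induced by X_b ↦ X_{(b,0)}. -/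
open MvPolynomial

/-- The ideal of relations `X_{(b,k+1)} = (X_{(b,k)})^p` in the polynomial ring on `B × ℕ`. -/
noncomputable def frobIdeal (p : ℕ) (B : Type) : Ideal (MvPolynomial (B × ℕ) (ZMod p)) :=
  Ideal.span {f | ∃ (b : B) (k : ℕ), f = X (b, k + 1) - (X (b, k)) ^ p}

/-- The free `uCom`-algebra with `⋆`-adapted Frobenius on the free Frobenius module on `B`
is isomorphic to the free polynomial algebra on `B`. -/
theorem free_adapted_frobenius_polynomial_iso (p : ℕ) [Fact p.Prime] (B : Type) :
    ∃ e : (MvPolynomial (B × ℕ) (ZMod p) ⧸ frobIdeal p B) ≃ₐ[ZMod p] MvPolynomial B (ZMod p),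
      (∀ q : MvPolynomial (B × ℕ) (ZMod p),
          e (Ideal.Quotient.mk (frobIdeal p B) q) =
            aeval (fun bk : B × ℕ => (X bk.1 : MvPolynomial B (ZMod p)) ^ p ^ bk.2) q) ∧
      (∀ b : B, e.symm (X b) = Ideal.Quotient.mk (frobIdeal p B) (X (b, 0))) := by
  have hle : ∀ a ∈ frobIdeal p B,
      aeval (fun bk : B × ℕ => (X bk.1 : MvPolynomial B (ZMod p)) ^ p ^ bk.2) a = 0 := by
    intro a ha
    have h : frobIdeal p B ≤ RingHom.ker
        (aeval (fun bk : B × ℕ => (X bk.1 : MvPolynomial B (ZMod p)) ^ p ^ bk.2) :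
          MvPolynomial (B × ℕ) (ZMod p) →ₐ[ZMod p] MvPolynomial B (ZMod p)) := by
      refine Ideal.span_le.2 ?_
      rintro f ⟨b, k, rfl⟩
      simp [RingHom.mem_ker, pow_succ, pow_mul]
    exact h ha
  have hpow : ∀ (b : B) (k : ℕ), Ideal.Quotient.mk (frobIdeal p B) (X (b, k)) =
      Ideal.Quotient.mk (frobIdeal p B) (X (b, 0)) ^ p ^ k := by
    intro b k
    induction k with
    | zero => simp
    | succ k ih =>
      rw [pow_succ, pow_mul, ← ih, ← map_pow, Ideal.Quotient.eq]
      exact Ideal.subset_span ⟨b, k, rfl⟩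
  let g : MvPolynomial B (ZMod p) →ₐ[ZMod p] (MvPolynomial (B × ℕ) (ZMod p) ⧸ frobIdeal p B) :=
    aeval (fun b => Ideal.Quotient.mk (frobIdeal p B) (X (b, 0)))
  refine ⟨AlgEquiv.ofAlgHom (Ideal.Quotient.liftₐ (frobIdeal p B) (aeval _) hle) g ?_ ?_, ?_, ?_⟩
  · apply MvPolynomial.algHom_ext
    intro b
    simp only [g, AlgHom.comp_apply, aeval_X, AlgHom.id_apply]
    refine (Ideal.Quotient.lift_mk _ _ _).trans ?_
    simp
  · apply Ideal.Quotient.algHom_ext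
    apply MvPolynomial.algHom_ext
    rintro ⟨b, k⟩
    change g (aeval (fun bk : B × ℕ => (X bk.1 : MvPolynomial B (ZMod p)) ^ p ^ bk.2)
      (X (b, k))) = Ideal.Quotient.mk (frobIdeal p B) (X (b, k))
    rw [hpow]
    simp [g]
  · intro q
    rfl
  · intro b
    change g (X b) = _
    simp [g]
end

section
/- Let p be a prime and B a type. In the multivariate polynomial ring (ZMod p)[X_{(b,k)} : b ∈ B, k ∈ ℕ], the ideal generated by the set {X_{(b,k+1)} − (X_{(b,k)})^p : b ∈ B, k ∈ ℕ} is equal to the ideal generated by the set {X_{(b,k)} − (X_{(b,0)})^{p^k} : b ∈ B, k ∈ ℕ}. -/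
open MvPolynomial

/-- In `(ZMod p)[X_{(b,k)} : b ∈ B, k ∈ ℕ]`, the ideal generated by the relations
`X_{(b,k+1)} − (X_{(b,k)})^p` equals the ideal generated by the relations
`X_{(b,k)} − (X_{(b,0)})^{p^k}`. -/
theorem frobenius_relations_ideal_eq (p : ℕ) [Fact p.Prime] (B : Type) :
    Ideal.span {f : MvPolynomial (B × ℕ) (ZMod p) |
        ∃ (b : B) (k : ℕ), f = X (b, k + 1) - (X (b, k)) ^ p} =
      Ideal.span {f : MvPolynomial (B × ℕ) (ZMod p) |
        ∃ (b : B) (k : ℕ), f = X (b, k) - (X (b, 0)) ^ p ^ k} := by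
  apply le_antisymm
  · rw [Ideal.span_le]
    rintro f ⟨b, k, rfl⟩
    rw [SetLike.mem_coe, ← Ideal.Quotient.eq_zero_iff_mem, map_sub, map_pow, sub_eq_zero]
    have h : ∀ k : ℕ, Ideal.Quotient.mk (Ideal.span {f : MvPolynomial (B × ℕ) (ZMod p) |
        ∃ (b : B) (k : ℕ), f = X (b, k) - (X (b, 0)) ^ p ^ k}) (X (b, k)) =
        (Ideal.Quotient.mk _ (X (b, 0))) ^ p ^ k := by
      intro k
      rw [← map_pow, Ideal.Quotient.eq]
      exact Ideal.subset_span ⟨b, k, rfl⟩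
    rw [h (k + 1), h k, ← pow_mul, pow_succ]
  · rw [Ideal.span_le]
    rintro f ⟨b, k, rfl⟩
    rw [SetLike.mem_coe, ← Ideal.Quotient.eq_zero_iff_mem, map_sub, map_pow, sub_eq_zero]
    have h : ∀ k : ℕ, Ideal.Quotient.mk (Ideal.span {f : MvPolynomial (B × ℕ) (ZMod p) |
        ∃ (b : B) (k : ℕ), f = X (b, k + 1) - (X (b, k)) ^ p}) (X (b, k + 1)) =
        (Ideal.Quotient.mk _ (X (b, k))) ^ p := by
      intro k
      rw [← map_pow, Ideal.Quotient.eq]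
      exact Ideal.subset_span ⟨b, k, rfl⟩
    induction k with
    | zero => simp
    | succ k ih => rw [h k, ih, ← pow_mul, pow_succ]
end

section
/- Let p be a prime, A a commutative (ZMod p)-algebra, φ : A → A a homomorphism of (ZMod p)-algebras, and S ⊆ A a subset that generates A as a (ZMod p)-algebra (i.e. Algebra.adjoin (ZMod p) S = ⊤). Then the ideal of A generated by the set {φ(a) − a^p : a ∈ A} is equal to the ideal of A generated by the set {φ(s) − s^p : s ∈ S}. -/
/-- For a commutative `(ZMod p)`-algebra `A` with an algebra endomorphism `φ` and a generating
subset `S`, the ideal generated by `{φ(a) − a^p : a ∈ A}` equals the ideal generated by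
`{φ(s) − s^p : s ∈ S}`. -/
theorem ideal_span_frobenius_differences_eq_of_adjoin_eq_top
    (p : ℕ) [Fact p.Prime] (A : Type) [CommRing A] [Algebra (ZMod p) A]
    (φ : A →ₐ[ZMod p] A) (S : Set A) (hS : Algebra.adjoin (ZMod p) S = ⊤) :
    Ideal.span {x : A | ∃ a : A, x = φ a - a ^ p} =
      Ideal.span {x : A | ∃ s ∈ S, x = φ s - s ^ p} := by
  rcases subsingleton_or_nontrivial A with hA | hA
  · exact Subsingleton.elim _ _
  haveI : CharP A p :=
    charP_of_injective_algebraMap (algebraMap (ZMod p) A).injective p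
  apply le_antisymm
  · rw [Ideal.span_le]
    rintro _ ⟨a, rfl⟩
    have ha : a ∈ Algebra.adjoin (ZMod p) S := by rw [hS]; trivial
    show φ a - a ^ p ∈ Ideal.span {x : A | ∃ s ∈ S, x = φ s - s ^ p}
    induction ha using Algebra.adjoin_induction with
    | mem s hs => exact Ideal.subset_span ⟨s, hs, rfl⟩
    | algebraMap r =>
      rw [AlgHom.commutes, ← map_pow, ZMod.pow_card, sub_self]
      exact Ideal.zero_mem _
    | add x y _ _ hx hy =>
      have h : φ (x + y) - (x + y) ^ p = (φ x - x ^ p) + (φ y - y ^ p) := by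
        rw [map_add, add_pow_char]; ring
      rw [h]
      exact Ideal.add_mem _ hx hy
    | mul x y _ _ hx hy =>
      have h : φ (x * y) - (x * y) ^ p = φ y * (φ x - x ^ p) + x ^ p * (φ y - y ^ p) := by
        rw [map_mul, mul_pow]; ring
      rw [h]
      exact Ideal.add_mem _ (Ideal.mul_mem_left _ _ hx) (Ideal.mul_mem_left _ _ hy)
  · apply Ideal.span_mono
    rintro _ ⟨s, _, rfl⟩
    exact ⟨s, rfl⟩
end

section
/- Let p be a prime, V : ℕ → Type a family of (ZMod p)-modules with V 0 trivial (a subsingleton), and φ_n : V n → V (p·n) an injective (ZMod p)-linear map for every n ∈ ℕ. Suppose given for each n a submodule C n of V n such that: if n = p·m for some m then C n and the range of φ_m are complementary submodules of V n (IsCompl), and if p does not divide n then C n = V n. For k ∈ ℕ and m ∈ ℕ write φ^{(k)} : V m → V (p^k·m) for the k-fold composite of the maps φ. Then for every n ≥ 1, the (ZMod p)-linear map from the direct sum ⊕_{k : p^k ∣ n} C(n/p^k) to V n sending a family (c_k) to Σ_k φ^{(k)}(c_k) is bijective (note that {k : p^k ∣ n} is finite since n ≥ 1 and p ≥ 2).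 -/
/-- Cast a linear map along an equality of indices. -/
noncomputable def castL (p : ℕ) (V : ℕ → Type) [∀ n, AddCommGroup (V n)]
    [∀ n, Module (ZMod p) (V n)] {a b : ℕ} (h : a = b) : V a →ₗ[ZMod p] V b :=
  h ▸ (LinearMap.id : V a →ₗ[ZMod p] V a)

/-- The `k`-fold iterate `φ^{(k)} : V m →ₗ V (p^k * m)` of the Frobenius maps `φ_n : V n → V (p*n)`. -/
noncomputable def iterFrob (p : ℕ) (V : ℕ → Type) [∀ n, AddCommGroup (V n)]
    [∀ n, Module (ZMod p) (V n)] (φ : ∀ n, V n →ₗ[ZMod p] V (p * n)) :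
    ∀ (k m : ℕ), V m →ₗ[ZMod p] V (p ^ k * m)
  | 0, m => castL p V (by rw [pow_zero, one_mul])
  | (k + 1), m =>
    (castL p V (show p * (p ^ k * m) = p ^ (k + 1) * m by ring)).comp
      ((φ (p ^ k * m)).comp (iterFrob p V φ k m))

section helpers
variable (p : ℕ) (V : ℕ → Type) [∀ n, AddCommGroup (V n)] [∀ n, Module (ZMod p) (V n)]

theorem castL_rfl {a : ℕ} (h : a = a) (x : V a) : castL p V h x = x := rfl

theorem castL_castL {a b c : ℕ} (h : a = b) (h' : b = c) (x : V a) :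
    castL p V h' (castL p V h x) = castL p V (h.trans h') x := by
  subst h; subst h'; rfl

theorem castL_phi (φ : ∀ n, V n →ₗ[ZMod p] V (p * n)) {a b : ℕ} (h : a = b) (x : V a) :
    φ b (castL p V h x) = castL p V (congrArg (p * ·) h) (φ a x) := by
  subst h; rfl

theorem castL_iter (φ : ∀ n, V n →ₗ[ZMod p] V (p * n)) (k : ℕ) {a b : ℕ} (h : a = b) (x : V a) :
    iterFrob p V φ k b (castL p V h x)
      = castL p V (congrArg (p ^ k * ·) h) (iterFrob p V φ k a x) := by
  subst h; rfl

noncomputable def castC (C : ∀ n, Submodule (ZMod p) (V n)) {a b : ℕ} (h : a = b) :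
    C a →ₗ[ZMod p] C b := h ▸ (LinearMap.id : C a →ₗ[ZMod p] C a)

theorem castC_coe (C : ∀ n, Submodule (ZMod p) (V n)) {a b : ℕ} (h : a = b) (x : C a) :
    ((castC p V C h x : C b) : V b) = castL p V h (x : V a) := by
  subst h; rfl

theorem castC_castC (C : ∀ n, Submodule (ZMod p) (V n)) {a b c : ℕ} (h : a = b) (h' : b = c)
    (x : C a) : castC p V C h' (castC p V C h x) = castC p V C (h.trans h') x := by
  subst h; subst h'; rfl

theorem castC_rfl (C : ∀ n, Submodule (ZMod p) (V n)) {a : ℕ} (h : a = a) (x : C a) :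
    castC p V C h x = x := rfl

noncomputable def TT (φ : ∀ n, V n →ₗ[ZMod p] V (p * n)) (C : ∀ n, Submodule (ZMod p) (V n))
    (n : ℕ) : (DirectSum {k : ℕ // p ^ k ∣ n} fun k => C (n / p ^ (k : ℕ))) →ₗ[ZMod p] V n :=
  DirectSum.toModule (ZMod p) {k : ℕ // p ^ k ∣ n} (V n)
        (fun k => (castL p V (Nat.mul_div_cancel' k.2)).comp
          ((iterFrob p V φ (k : ℕ) (n / p ^ (k : ℕ))).comp
            (C (n / p ^ (k : ℕ))).subtype))

theorem TT_lof (φ : ∀ n, V n →ₗ[ZMod p] V (p * n)) (C : ∀ n, Submodule (ZMod p) (V n))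
    (n : ℕ) (k : {k : ℕ // p ^ k ∣ n}) (c : C (n / p ^ (k : ℕ))) :
    TT p V φ C n (DirectSum.lof (ZMod p) _ (fun k : {k : ℕ // p ^ k ∣ n} => C (n / p ^ (k : ℕ))) k c)
      = castL p V (Nat.mul_div_cancel' k.2) (iterFrob p V φ k _ (c : V _)) := by
  unfold TT
  rw [DirectSum.toModule_lof]; rfl

/-- degree zero inclusion -/
noncomputable def I0 (C : ∀ n, Submodule (ZMod p) (V n)) (n : ℕ) :
    C n →ₗ[ZMod p] (DirectSum {k : ℕ // p ^ k ∣ n} fun k => C (n / p ^ (k : ℕ))) :=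
  (DirectSum.lof (ZMod p) _ (fun k : {k : ℕ // p ^ k ∣ n} => C (n / p ^ (k : ℕ)))
    ⟨0, by simp⟩).comp (castC p V C (by simp))

theorem TT_I0 (φ : ∀ n, V n →ₗ[ZMod p] V (p * n)) (C : ∀ n, Submodule (ZMod p) (V n))
    (n : ℕ) (c : C n) : TT p V φ C n (I0 p V C n c) = c := by
  unfold I0
  rw [LinearMap.comp_apply, TT_lof]
  simp only [iterFrob, castC_coe, castL_castL]
  rfl


theorem shift_eq [hp : Fact p.Prime] (m k : ℕ) : m / p ^ k = p * m / p ^ (k + 1) := by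
  rw [pow_succ', Nat.mul_div_mul_left _ _ hp.out.pos]

noncomputable def SS [hp : Fact p.Prime] (C : ∀ n, Submodule (ZMod p) (V n)) (m : ℕ) :
    (DirectSum {k : ℕ // p ^ k ∣ m} fun k => C (m / p ^ (k : ℕ))) →ₗ[ZMod p]
    (DirectSum {k : ℕ // p ^ k ∣ p * m} fun k => C (p * m / p ^ (k : ℕ))) :=
  DirectSum.toModule (ZMod p) _ _ fun k =>
    (DirectSum.lof (ZMod p) _ (fun k : {k : ℕ // p ^ k ∣ p * m} => C (p * m / p ^ (k : ℕ)))
      ⟨k + 1, by rw [pow_succ']; exact Nat.mul_dvd_mul_left p k.2⟩).comp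
      (castC p V C (shift_eq p m k))

theorem SS_lof [hp : Fact p.Prime] (C : ∀ n, Submodule (ZMod p) (V n)) (m : ℕ) (k : {k : ℕ // p ^ k ∣ m})
    (c : C (m / p ^ (k : ℕ))) :
    SS p V C m (DirectSum.lof (ZMod p) _ (fun k : {k : ℕ // p ^ k ∣ m} => C (m / p ^ (k : ℕ))) k c)
    = DirectSum.lof (ZMod p) _ (fun k : {k : ℕ // p ^ k ∣ p * m} => C (p * m / p ^ (k : ℕ)))
      ⟨k + 1, by rw [pow_succ']; exact Nat.mul_dvd_mul_left p k.2⟩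
      (castC p V C (shift_eq p m k) c) := by
  unfold SS
  rw [DirectSum.toModule_lof]; rfl

theorem TT_SS [hp : Fact p.Prime] (φ : ∀ n, V n →ₗ[ZMod p] V (p * n)) (C : ∀ n, Submodule (ZMod p) (V n)) (m : ℕ)
    (y : DirectSum {k : ℕ // p ^ k ∣ m} fun k => C (m / p ^ (k : ℕ))) :
    TT p V φ C (p * m) (SS p V C m y) = φ m (TT p V φ C m y) := by
  have : (TT p V φ C (p * m)).comp (SS p V C m) = (φ m).comp (TT p V φ C m) := by
    apply DirectSum.linearMap_ext
    intro k
    ext c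
    simp only [LinearMap.comp_apply]
    rw [SS_lof, TT_lof, TT_lof, castC_coe, castL_iter, castL_castL, castL_phi]
    simp only [iterFrob, LinearMap.comp_apply]
    rw [castL_castL]
  exact LinearMap.congr_fun this y

theorem decomp [hp : Fact p.Prime] (C : ∀ n, Submodule (ZMod p) (V n)) (m : ℕ)
    (x : DirectSum {k : ℕ // p ^ k ∣ p * m} fun k => C (p * m / p ^ (k : ℕ))) :
    ∃ c y, x = I0 p V C (p * m) c + SS p V C m y := by
  induction x using DirectSum.induction_on with
  | zero => exact ⟨0, 0, by simp⟩
  | add x x' hx hx' =>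
    obtain ⟨c, y, rfl⟩ := hx
    obtain ⟨c', y', rfl⟩ := hx'
    exact ⟨c + c', y + y', by rw [map_add, map_add]; abel⟩
  | of k c =>
    obtain ⟨k, hk⟩ := k
    cases k with
    | zero =>
      refine ⟨castC p V C (by simp) c, 0, ?_⟩
      rw [map_zero, add_zero, I0, LinearMap.comp_apply, castC_castC, castC_rfl]
      rfl
    | succ k =>
      have hk' : p ^ k ∣ m := by
        rw [pow_succ'] at hk
        exact Nat.dvd_of_mul_dvd_mul_left hp.out.pos hk
      refine ⟨0, DirectSum.lof (ZMod p) _ (fun k : {k : ℕ // p ^ k ∣ m} => C (m / p ^ (k : ℕ)))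
        ⟨k, hk'⟩ (castC p V C (shift_eq p m k).symm c), ?_⟩
      rw [map_zero, zero_add, SS_lof, castC_castC, castC_rfl]
      rfl

theorem decomp' (C : ∀ n, Submodule (ZMod p) (V n)) (n : ℕ) (hn : ¬ p ∣ n)
    (x : DirectSum {k : ℕ // p ^ k ∣ n} fun k => C (n / p ^ (k : ℕ))) :
    ∃ c, x = I0 p V C n c := by
  induction x using DirectSum.induction_on with
  | zero => exact ⟨0, by simp⟩
  | add x x' hx hx' =>
    obtain ⟨c, rfl⟩ := hx
    obtain ⟨c', rfl⟩ := hx'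
    exact ⟨c + c', by rw [map_add]⟩
  | of k c =>
    obtain ⟨k, hk⟩ := k
    cases k with
    | zero =>
      refine ⟨castC p V C (by simp) c, ?_⟩
      rw [I0, LinearMap.comp_apply, castC_castC, castC_rfl]
      rfl
    | succ k => exact absurd ((Dvd.intro_left _ (pow_succ p k).symm).trans hk) hn

theorem TT_bij [hp : Fact p.Prime] (φ : ∀ n, V n →ₗ[ZMod p] V (p * n)) (hφ : ∀ n, Function.Injective (φ n))
    (C : ∀ n, Submodule (ZMod p) (V n))
    (hC1 : ∀ m, IsCompl (C (p * m)) (LinearMap.range (φ m)))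
    (hC2 : ∀ n, ¬ p ∣ n → C n = ⊤) (n : ℕ) (hn : 1 ≤ n) :
    Function.Bijective (TT p V φ C n) := by
  induction n using Nat.strong_induction_on with
  | _ n ih =>
  by_cases hd : p ∣ n
  · obtain ⟨m, rfl⟩ := hd
    have hm : 1 ≤ m := Nat.pos_of_ne_zero (by rintro rfl; simp at hn)
    obtain ⟨hi, hs⟩ := ih m (by nlinarith [hp.out.two_le]) hm
    constructor
    · rw [injective_iff_map_eq_zero]
      intro x hx
      obtain ⟨c, y, rfl⟩ := decomp p V C m x
      rw [map_add, TT_I0, TT_SS] at hx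
      have hc : (c : V (p * m)) = 0 := by
        refine Submodule.disjoint_def.1 (hC1 m).disjoint _ c.2 ?_
        rw [eq_neg_of_add_eq_zero_left hx]
        exact neg_mem ⟨_, rfl⟩
      rw [hc, zero_add] at hx
      have hy : y = 0 := hi ((hφ m (hx.trans (map_zero _).symm)).trans (map_zero _).symm)
      have hc' : c = 0 := Subtype.ext hc
      rw [hy, hc', map_zero, map_zero, add_zero]
    · intro v
      have hv : v ∈ C (p * m) ⊔ LinearMap.range (φ m) := by
        rw [(hC1 m).sup_eq_top]; trivial
      obtain ⟨c, hc, _, ⟨w, rfl⟩, rfl⟩ := Submodule.mem_sup.1 hv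
      obtain ⟨y, rfl⟩ := hs w
      exact ⟨I0 p V C (p * m) ⟨c, hc⟩ + SS p V C m y, by rw [map_add, TT_I0, TT_SS]⟩
  · constructor
    · rw [injective_iff_map_eq_zero]
      intro x hx
      obtain ⟨c, rfl⟩ := decomp' p V C n hd x
      rw [TT_I0] at hx
      have hc' : c = 0 := Subtype.ext hx
      rw [hc', map_zero]
    · intro v
      exact ⟨I0 p V C n ⟨v, by rw [hC2 n hd]; trivial⟩, by rw [TT_I0]⟩

end helpers

/-- If `V` is a connected graded module with injective Frobenius maps `φ_n : V n → V (p·n)`,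
and `C n` is a complement of the image of the Frobenius in each degree (all of `V n` when
`p ∤ n`), then for `n ≥ 1` the map `⊕_{k : p^k ∣ n} C(n/p^k) → V n`, `(c_k) ↦ Σ_k φ^{(k)}(c_k)`,
is bijective. -/
theorem directSum_section_iterFrob_bijective
    (p : ℕ) [Fact p.Prime] (V : ℕ → Type) [∀ n, AddCommGroup (V n)]
    [∀ n, Module (ZMod p) (V n)] [Subsingleton (V 0)]
    (φ : ∀ n, V n →ₗ[ZMod p] V (p * n)) (hφ : ∀ n, Function.Injective (φ n))
    (C : ∀ n, Submodule (ZMod p) (V n))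
    (hC1 : ∀ m, IsCompl (C (p * m)) (LinearMap.range (φ m)))
    (hC2 : ∀ n, ¬ p ∣ n → C n = ⊤)
    (n : ℕ) (hn : 1 ≤ n) :
    Function.Bijective
      (DirectSum.toModule (ZMod p) {k : ℕ // p ^ k ∣ n} (V n)
        (fun k => (castL p V (Nat.mul_div_cancel' k.2)).comp
          ((iterFrob p V φ (k : ℕ) (n / p ^ (k : ℕ))).comp
            (C (n / p ^ (k : ℕ))).subtype))) := by
  exact TT_bij p V φ hφ C hC1 hC2 n hn
end

section
/- Let p be a prime, s ≥ 1 an integer, K = GaloisField p s (the finite field with p^s elements), and φ : K → K the Frobenius map x ↦ x^p, which is (ZMod p)-linear. Let N be a (ZMod p)-module and d : N ≃ N a (ZMod p)-linear automorphism satisfying d^s = id. Then there exists a (ZMod p)-linear automorphism β of the tensor product K ⊗_{ZMod p} N such that β ∘ (φ ⊗ id_N) = (φ ⊗ d) ∘ β, where φ ⊗ id_N and φ ⊗ d denote the induced (ZMod p)-linear endomorphisms of K ⊗_{ZMod p} N. -/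
open TensorProduct

/-- The map acting on `b g ⊗ n` by `b g ⊗ r g n`. -/
noncomputable def diagMap {R L N G : Type*} [CommRing R] [AddCommGroup L] [Module R L]
    [AddCommGroup N] [Module R N] (b : Module.Basis G R L) (r : G → N →ₗ[R] N) :
    L ⊗[R] N →ₗ[R] L ⊗[R] N :=
  TensorProduct.lift (b.constr R (fun g => (TensorProduct.mk R L N (b g)) ∘ₗ r g))

theorem diagMap_apply {R L N G : Type*} [CommRing R] [AddCommGroup L] [Module R L]
    [AddCommGroup N] [Module R N] (b : Module.Basis G R L) (r : G → N →ₗ[R] N) (g : G) (n : N) :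
    diagMap b r (b g ⊗ₜ n) = b g ⊗ₜ r g n := by
  simp [diagMap, Module.Basis.constr_basis]

theorem ext_basis_tmul {R L N G P : Type*} [CommRing R] [AddCommGroup L] [Module R L]
    [AddCommGroup N] [Module R N] [AddCommGroup P] [Module R P] (b : Module.Basis G R L)
    (f h : L ⊗[R] N →ₗ[R] P) (H : ∀ g n, f (b g ⊗ₜ n) = h (b g ⊗ₜ n)) : f = h := by
  apply TensorProduct.ext
  apply b.ext
  intro g
  ext n
  exact H g n

/-- Straightening a cyclic twist: for the Frobenius `φ` of `F_{p^s}` and an order-`s`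
automorphism `d` of a `(ZMod p)`-module `N`, there is a linear automorphism `β` of
`F_{p^s} ⊗ N` intertwining `φ ⊗ id` and `φ ⊗ d`. -/
theorem exists_straightening_automorphism
    (p s : ℕ) [Fact p.Prime] (hs : 1 ≤ s)
    (N : Type) [AddCommGroup N] [Module (ZMod p) N]
    (d : N ≃ₗ[ZMod p] N) (hd : d ^ s = 1)
    (φ : GaloisField p s →ₗ[ZMod p] GaloisField p s) (hφ : ∀ x, φ x = x ^ p) :
    ∃ β : (GaloisField p s ⊗[ZMod p] N) ≃ₗ[ZMod p] (GaloisField p s ⊗[ZMod p] N),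
      β.toLinearMap ∘ₗ TensorProduct.map φ (LinearMap.id : N →ₗ[ZMod p] N) =
        TensorProduct.map φ d.toLinearMap ∘ₗ β.toLinearMap := by
  let F := FiniteField.frobeniusAlgEquivOfAlgebraic (ZMod p) (GaloisField p s)
  have hF : orderOf F = s := by
    rw [FiniteField.orderOf_frobeniusAlgEquivOfAlgebraic, GaloisField.finrank p (by omega)]
  have hFφ : ∀ x, φ x = F x := by
    intro x
    rw [hφ, FiniteField.coe_frobeniusAlgEquivOfAlgebraic, ZMod.card]
  have hex : ∀ g : Gal(GaloisField p s/ZMod p), ∃ k : ℕ, F ^ k = g := fun g =>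
    have ⟨n, hn⟩ := (FiniteField.bijective_frobeniusAlgEquivOfAlgebraic_pow
      (ZMod p) (GaloisField p s)).2 g
    ⟨n, hn⟩
  choose k hk using hex
  have hρ : ∀ g, d ^ k (F * g) = d * d ^ k g := by
    intro g
    have h1 : F ^ k (F * g) = F ^ (k g + 1) := by rw [hk, pow_succ', hk]
    rw [pow_eq_pow_iff_modEq, hF] at h1
    rw [← pow_succ', pow_eq_pow_iff_modEq]
    exact h1.of_dvd (orderOf_dvd_of_pow_eq_one hd)
  let b := IsGalois.normalBasis (ZMod p) (GaloisField p s)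
  have hb : ∀ g, φ (b g) = b (F * g) := by
    intro g
    rw [hFφ, IsGalois.normalBasis_apply g, IsGalois.normalBasis_apply (F * g)]
    rfl
  refine ⟨LinearEquiv.ofLinear (diagMap b fun g => (d ^ k g).toLinearMap)
    (diagMap b fun g => (d ^ k g).symm.toLinearMap) ?_ ?_, ?_⟩
  · apply ext_basis_tmul b
    intro g n
    simp [diagMap_apply]
  · apply ext_basis_tmul b
    intro g n
    simp [diagMap_apply]
  · apply ext_basis_tmul b
    intro g n
    simp only [LinearMap.comp_apply, TensorProduct.map_tmul, LinearEquiv.ofLinear_toLinearMap,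
      diagMap_apply, hb, LinearMap.id_apply, LinearEquiv.coe_coe, hρ]
    rfl
end

section
/- Let p be a prime and R a commutative ring of characteristic p (CharP R p). Then for all elements s, t ∈ R, the identity (Σ_{i=0}^{p−1} s^{p−i}·t^i)^p · t^p = (Σ_{i=0}^{p−1} t^{p−i}·s^i)^p · s^p holds in R. -/
/-- The Bullett–McDonald symmetry identity: in a commutative ring of characteristic `p`,
`(Σ_{i<p} s^{p−i} t^i)^p · t^p = (Σ_{i<p} t^{p−i} s^i)^p · s^p`. -/
theorem bullett_mcdonald_symmetry (p : ℕ) [Fact p.Prime]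
    (R : Type) [CommRing R] [CharP R p] (s t : R) :
    (∑ i ∈ Finset.range p, s ^ (p - i) * t ^ i) ^ p * t ^ p =
      (∑ i ∈ Finset.range p, t ^ (p - i) * s ^ i) ^ p * s ^ p := by
  rw [← mul_pow, ← mul_pow]
  congr 1
  rw [Finset.sum_mul, Finset.sum_mul, ← Finset.sum_range_reflect]
  refine Finset.sum_congr rfl fun i hi => ?_
  have hi' : i < p := Finset.mem_range.mp hi
  have h1 : p - (p - 1 - i) = i + 1 := by omega
  have h2 : p - i = (p - 1 - i) + 1 := by omega
  rw [h1, h2]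
  ring
end
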